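/- arXiv:1904.06981 — 3 statements merged into one kernel-verified Lean document; each statement's English description precedes it below -/
import Mathlib

section
/- Let ε ∈ (0,1) be a constant and let μ, λ be positive integers with μ ≤ λ ≤ (1 − ε)·e·μ. Consider a run of the (μ,λ) EA on the n-dimensional OneMax function with population sequence (P_t). If n is large enough, then for every t, E[g(P_{t+1}) | P_t] ≤ g(P_t) + 2λ, where g(P) = Σ_{x∈P} g(x) is the population potential built from τ = 4e/ε. -/
open Finset
open scoped ENNReal

attribute [local instance] Classical.propDecidable

/-- Search points: bit strings of length `n`. -/
abbrev Pt (n : ℕ) := Fin n → Bool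

/-- The OneMax fitness: the number of one-bits. -/
noncomputable def oneMax {n : ℕ} (x : Pt n) : ℕ := (univ.filter (fun i => x i = true)).card

/-- The all-ones string (the unique optimum of OneMax). -/
noncomputable def allOnes (n : ℕ) : Pt n := fun _ => true

/-- Probability that standard-bit mutation (flip each bit independently with
probability `1/n`) turns `x` into `y`. -/
noncomputable def mutProb (n : ℕ) (x y : Pt n) : ℝ :=
  ∏ i : Fin n, (if y i = x i then 1 - 1 / (n : ℝ) else 1 / (n : ℝ))

/-- `binomPr m p k` is the probability that a `Bin(m, p)` random variable equals `k`. -/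
noncomputable def binomPr (m : ℕ) (p : ℝ) (k : ℕ) : ℝ :=
  (m.choose k : ℝ) * p ^ k * (1 - p) ^ (m - k)

/-- Probability that `min μ B = j`, where `B ~ Bin(lam, p)`. -/
noncomputable def binomTruncPr (μ lam : ℕ) (p : ℝ) (j : ℕ) : ℝ :=
  if j < μ then binomPr lam p j
  else if j = μ then ∑ k ∈ Finset.Icc μ lam, binomPr lam p k
  else 0

/-- The potential of a single individual. -/
noncomputable def gPot (n : ℕ) (τ : ℝ) (f₀ : ℕ) (x : Pt n) : ℝ :=
  if f₀ ≤ oneMax x then τ ^ (oneMax x - f₀) else 0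

/-- The potential of a population. -/
noncomputable def gPop (n μ : ℕ) (τ : ℝ) (f₀ : ℕ) (P : Fin μ → Pt n) : ℝ :=
  ∑ i, gPot n τ f₀ (P i)

/-- Probability that one offspring-creation step (choose a parent uniformly at random
from the population `P`, then apply standard-bit mutation) produces `y`. -/
noncomputable def offProb (n μ : ℕ) (P : Fin μ → Pt n) (y : Pt n) : ℝ :=
  (∑ i, mutProb n (P i) y) / (μ : ℝ)

/-- Probability that the `lam` independently created offspring are exactly `o`. -/
noncomputable def offVecProb (n μ lam : ℕ) (P : Fin μ → Pt n) (o : Fin lam → Pt n) : ℝ :=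
  ∏ j, offProb n μ P (o j)

/-- `s` selects `μ` of the `lam` offspring `o` having the largest OneMax values. -/
def validSel {n μ lam : ℕ} (o : Fin lam → Pt n) (s : Fin μ → Fin lam) : Prop :=
  Function.Injective s ∧
    ∀ j : Fin lam, (∀ i, s i ≠ j) → ∀ i, oneMax (o j) ≤ oneMax (o (s i))

/-- Transition probability of the (μ,λ) EA on OneMax: the probability that the next
population is `Q`, given that the current one is `P`; the `μ` best of the `lam`
offspring are selected, ties broken uniformly at random. -/
noncomputable def stepProb (n μ lam : ℕ) (P Q : Fin μ → Pt n) : ℝ :=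
  ∑ o : Fin lam → Pt n, offVecProb n μ lam P o *
    (((univ.filter (fun s : Fin μ → Fin lam => validSel o s ∧ o ∘ s = Q)).card : ℝ) /
      ((univ.filter (fun s : Fin μ → Fin lam => validSel o s)).card : ℝ))

/-- Probability of observing the population path `path`, where the initial population
consists of `μ` individuals chosen independently and uniformly at random. -/
noncomputable def pathProb (n μ lam : ℕ) {t : ℕ} (path : Fin (t + 1) → Fin μ → Pt n) : ℝ :=
  ((1 : ℝ) / 2 ^ n) ^ μ * ∏ s : Fin t, stepProb n μ lam (path s.castSucc) (path s.succ)

/-- Probability that none of the populations `P_0, …, P_t` contains the optimum. -/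
noncomputable def survProb (n μ lam t : ℕ) : ℝ :=
  ∑ path ∈ (univ : Finset (Fin (t + 1) → Fin μ → Pt n)).filter
      (fun path => ∀ s i, path s i ≠ allOnes n),
    pathProb n μ lam path

/-- Expected number of generations of the (μ,λ) EA on OneMax until the all-ones
string is first generated. -/
noncomputable def expGens (n μ lam : ℕ) : ℝ≥0∞ :=
  ∑' t : ℕ, ENNReal.ofReal (survProb n μ lam t)

/-- Expected runtime (number of fitness evaluations) of the (μ,λ) EA on OneMax:
`μ` evaluations for the initial population plus `lam` per generation. -/
noncomputable def expRuntime (n μ lam : ℕ) : ℝ≥0∞ :=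
  (μ : ℝ≥0∞) + (lam : ℝ≥0∞) * expGens n μ lam

/-- Number of individuals of the population with fitness exactly `φ`. -/
noncomputable def cntEq {n μ : ℕ} (P : Fin μ → Pt n) (φ : ℕ) : ℕ :=
  (univ.filter (fun i => oneMax (P i) = φ)).card

/-- Number of individuals of the population with fitness strictly greater than `φ`. -/
noncomputable def cntGt {n μ : ℕ} (P : Fin μ → Pt n) (φ : ℕ) : ℕ :=
  (univ.filter (fun i => φ < oneMax (P i))).card

/-- `φ` is the current level at generation `t` of the population path `path`. -/
def isCurLevel {n : ℕ} (μ : ℕ) (path : ℕ → Fin μ → Pt n) (t φ : ℕ) : Prop :=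
  ∃ t₀ < t, (μ : ℝ) / 2 ≤ (cntEq (path t₀) φ : ℝ) + (cntGt (path t₀) φ : ℝ) ∧
    ∀ τ, t₀ ≤ τ → τ ≤ t →
      (μ : ℝ) / 4 ≤ (cntEq (path τ) φ : ℝ) + (cntGt (path τ) φ : ℝ) ∧
        (cntGt (path τ) φ : ℝ) < (μ : ℝ) / 2

/-- Probability that the population path of length `t + 1` of the (μ,λ) EA started
from the fixed population `P₀` satisfies the predicate `good`. -/
noncomputable def prEvent (n μ lam : ℕ) (P₀ : Fin μ → Pt n) (t : ℕ)
    (good : (Fin (t + 1) → Fin μ → Pt n) → Prop) : ℝ :=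
  ∑ path ∈ (univ : Finset (Fin (t + 1) → Fin μ → Pt n)).filter
      (fun path => path 0 = P₀ ∧ good path),
    ∏ s : Fin t, stepProb n μ lam (path s.castSucc) (path s.succ)

/-- The population `Q` has lost the level `φ`: fewer than `μ/4` individuals have
fitness at least `φ`. -/
def lostLevel {n μ : ℕ} (φ : ℕ) (Q : Fin μ → Pt n) : Prop :=
  (cntEq Q φ : ℝ) + (cntGt Q φ : ℝ) < (μ : ℝ) / 4

/-- The population `Q` has gained a level over `φ`: at least `μ/2` individuals have
fitness strictly greater than `φ`. -/
def gainLevel {n μ : ℕ} (φ : ℕ) (Q : Fin μ → Pt n) : Prop :=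
  (μ : ℝ) / 2 ≤ (cntGt Q φ : ℝ)

lemma aux_prodsum {m : ℕ} {β : Type*} [Fintype β] (f : Fin m → β → ℝ) :
    ∑ o : Fin m → β, ∏ j, f j (o j) = ∏ j, ∑ y, f j y := by
  rw [Finset.prod_univ_sum, Fintype.piFinset_univ]

lemma aux_prod_ite (n : ℕ) (a b : ℝ) (x : Pt n) :
    ∏ i : Fin n, (if x i = true then a else b) = a ^ (oneMax x) * b ^ (n - oneMax x) := by
  rw [Finset.prod_ite, Finset.prod_const, Finset.prod_const]
  have h := Finset.card_filter_add_card_filter_not (s := (univ : Finset (Fin n)))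
    (fun i => x i = true)
  rw [Finset.card_univ, Fintype.card_fin] at h
  have h2 : (univ.filter (fun i => ¬ x i = true)).card = n - oneMax x := by
    unfold oneMax
    omega
  rw [h2]
  rfl

lemma aux_oneMax_le {n : ℕ} (x : Pt n) : oneMax x ≤ n := by
  unfold oneMax
  refine (Finset.card_filter_le _ _).trans ?_
  simp

lemma aux_mgf (n : ℕ) (τ : ℝ) (x : Pt n) :
    ∑ y, mutProb n x y * τ ^ (oneMax y) =
      ((1 - 1 / (n : ℝ)) * τ + 1 / (n : ℝ)) ^ (oneMax x) *
        ((1 - 1 / (n : ℝ)) + 1 / (n : ℝ) * τ) ^ (n - oneMax x) := by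
  have h : ∀ y : Pt n, mutProb n x y * τ ^ (oneMax y) =
      ∏ i, ((if y i = x i then 1 - 1 / (n : ℝ) else 1 / (n : ℝ)) *
        (if y i = true then τ else 1)) := by
    intro y
    rw [Finset.prod_mul_distrib, aux_prod_ite]
    simp [mutProb]
  simp_rw [h]
  rw [aux_prodsum (fun i b => (if b = x i then 1 - 1 / (n : ℝ) else 1 / (n : ℝ)) *
        (if b = true then τ else 1)), ← aux_prod_ite]
  refine Finset.prod_congr rfl fun i _ => ?_
  rw [Fintype.sum_bool]
  cases x i <;> simp <;> ring

lemma aux_mut_sum (n : ℕ) (x : Pt n) : ∑ y, mutProb n x y = 1 := by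
  have h := aux_mgf n 1 x
  simpa using h

lemma aux_mut_nonneg (n : ℕ) (hn : 1 ≤ n) (x y : Pt n) : 0 ≤ mutProb n x y := by
  have h : (1 : ℝ) ≤ n := by exact_mod_cast hn
  have h1 : 1 / (n : ℝ) ≤ 1 := by
    rw [div_le_one (by linarith)]; exact h
  unfold mutProb
  refine Finset.prod_nonneg fun i _ => ?_
  split_ifs
  · linarith
  · positivity

lemma aux_off_sum (n μ : ℕ) (hμ : 0 < μ) (P : Fin μ → Pt n) : ∑ y, offProb n μ P y = 1 := by
  have h : (μ : ℝ) ≠ 0 := by exact_mod_cast hμ.ne'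
  unfold offProb
  rw [← Finset.sum_div, Finset.sum_comm]
  simp [aux_mut_sum, h]

lemma aux_off_nonneg (n μ : ℕ) (hn : 1 ≤ n) (P : Fin μ → Pt n) (y : Pt n) :
    0 ≤ offProb n μ P y :=
  div_nonneg (Finset.sum_nonneg fun i _ => aux_mut_nonneg n hn _ _) (Nat.cast_nonneg _)

lemma aux_lin (n μ lam : ℕ) (hμ : 0 < μ) (P : Fin μ → Pt n) (G : Pt n → ℝ) :
    ∑ o : Fin lam → Pt n, offVecProb n μ lam P o * ∑ j, G (o j) =
      lam * ∑ y, offProb n μ P y * G y := by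
  simp_rw [Finset.mul_sum]
  rw [Finset.sum_comm]
  have h : ∀ j : Fin lam, ∑ o : Fin lam → Pt n, offVecProb n μ lam P o * G (o j) =
      ∑ y, offProb n μ P y * G y := by
    intro j
    have h1 : ∀ o : Fin lam → Pt n, offVecProb n μ lam P o * G (o j) =
        ∏ i, (offProb n μ P (o i) * (if i = j then G (o i) else 1)) := by
      intro o
      rw [Finset.prod_mul_distrib, Finset.prod_ite_eq' univ j (fun i => G (o i))]
      simp [offVecProb]
    simp_rw [h1]
    rw [aux_prodsum (fun i y => offProb n μ P y * (if i = j then G y else 1)),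
      Finset.prod_eq_single j]
    · simp
    · intro b _ hb
      simp [hb, aux_off_sum n μ hμ P]
    · simp
  simp_rw [h]
  simp [Finset.mul_sum]

lemma aux_step (n μ lam : ℕ) (hn : 1 ≤ n) (hμ : 0 < μ) (P : Fin μ → Pt n) (G : Pt n → ℝ)
    (hG : ∀ x, 0 ≤ G x) :
    ∑ Q : Fin μ → Pt n, stepProb n μ lam P Q * ∑ i, G (Q i) ≤
      lam * ∑ y, offProb n μ P y * G y := by
  rw [← aux_lin n μ lam hμ P G]
  unfold stepProb
  simp_rw [Finset.sum_mul]
  rw [Finset.sum_comm]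
  refine Finset.sum_le_sum fun o _ => ?_
  simp_rw [mul_assoc]
  rw [← Finset.mul_sum]
  refine mul_le_mul_of_nonneg_left ?_
    (Finset.prod_nonneg fun j _ => aux_off_nonneg n μ hn P _)
  have hS : 0 ≤ ∑ j, G (o j) := Finset.sum_nonneg fun j _ => hG _
  simp_rw [div_mul_eq_mul_div]
  rw [← Finset.sum_div]
  refine div_le_of_le_mul₀ (Nat.cast_nonneg _) hS ?_
  have h1 : ∀ Q : Fin μ → Pt n,
      ((univ.filter (fun s : Fin μ → Fin lam => validSel o s ∧ o ∘ s = Q)).card : ℝ) *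
        ∑ i, G (Q i) =
      ∑ s ∈ (univ.filter (fun s : Fin μ → Fin lam => validSel o s)),
        if o ∘ s = Q then ∑ i, G (Q i) else 0 := by
    intro Q
    rw [← Finset.sum_filter, Finset.filter_filter, Finset.sum_const, nsmul_eq_mul]
  simp_rw [h1]
  rw [Finset.sum_comm]
  simp only [Finset.sum_ite_eq, Finset.mem_univ, if_true]
  rw [mul_comm, ← nsmul_eq_mul]
  refine Finset.sum_le_card_nsmul _ _ _ fun s hs => ?_
  have hinj : Function.Injective s := (Finset.mem_filter.mp hs).2.1
  have h2 : ∑ i, G ((o ∘ s) i) = ∑ j ∈ univ.image s, G (o j) := by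
    rw [Finset.sum_image (fun a _ b _ h => hinj h)]
    rfl
  rw [h2]
  exact Finset.sum_le_sum_of_subset_of_nonneg (Finset.subset_univ _) fun j _ _ => hG _

lemma aux_pow_exp (x : ℝ) (h : 0 ≤ 1 + x) (k : ℕ) : (1 + x) ^ k ≤ Real.exp (k * x) := by
  rw [Real.exp_nat_mul]
  exact pow_le_pow_left₀ h (by linarith [Real.add_one_le_exp x]) k

/-- Main analytic estimate. -/
lemma aux_core (n k : ℕ) (τ α : ℝ) (hn : 2 ≤ n) (hτ : 1 < τ) (hk : k ≤ n)
    (hα : α = 1 - (1 / τ) * Real.log (1 + 1 / τ)) (hk2 : α * n ≤ k) :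
    (1 - (1 - 1 / τ) / n) ^ k * (1 + (τ - 1) / n) ^ (n - k) ≤ Real.exp (2 / τ - 1) := by
  have hn' : (2 : ℝ) ≤ n := by exact_mod_cast hn
  have hn0 : (0 : ℝ) < n := by linarith
  set δ := 1 / τ with hδ
  have hτ0 : 0 < τ := by linarith
  have hδ0 : 0 < δ := by positivity
  have hδ1 : δ < 1 := by rw [hδ, div_lt_one hτ0]; exact hτ
  have hτδ : τ * δ = 1 := by rw [hδ]; field_simp
  set L := Real.log (1 + δ) with hL
  have hL1 : L ≤ δ := by
    have := Real.log_le_sub_one_of_pos (show 0 < 1 + δ by linarith)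
    linarith
  have hL0 : 0 ≤ L := Real.log_nonneg (by linarith)
  have hq : (1 - δ) / n ≤ 1 := by
    rw [div_le_one hn0]; linarith
  have e1 := aux_pow_exp (-((1 - δ) / n)) (by linarith) k
  have hA0 : 0 ≤ (τ - 1) / n := div_nonneg (by linarith) hn0.le
  have e2 := aux_pow_exp ((τ - 1) / n) (by linarith) (n - k)
  rw [← sub_eq_add_neg] at e1
  refine (mul_le_mul e1 e2 (by positivity) (by positivity)).trans ?_
  rw [← Real.exp_add]
  apply Real.exp_le_exp.mpr
  rw [Nat.cast_sub hk]
  obtain ⟨r, hr⟩ : ∃ r : ℝ, r = (k : ℝ) / n := ⟨_, rfl⟩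
  have hkr : (k : ℝ) = r * n := by rw [hr]; field_simp
  have hr1 : α ≤ r := by rw [hr, le_div_iff₀ hn0]; exact hk2
  have : (k : ℝ) * -((1 - δ) / n) + (n - k) * ((τ - 1) / n) =
      -(r * (1 - δ)) + (1 - r) * (τ - 1) := by
    rw [hkr]; field_simp
  rw [this]
  have h2 : 2 / τ = 2 * δ := by rw [hδ]; ring
  rw [h2]
  have hs : 1 - r ≤ δ * L := by linarith
  have h3 : (1 - r) * (τ - 1) ≤ δ * L * (τ - 1) :=
    mul_le_mul_of_nonneg_right hs (by linarith)
  have h4 : (1 - r) * (1 - δ) ≤ δ * L * (1 - δ) :=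
    mul_le_mul_of_nonneg_right hs (by linarith)
  have h5 : δ * L * (τ - 1) = L * (1 - δ) := by linear_combination L * hτδ
  have h6 : L * (1 - δ) * (1 + δ) ≤ δ := by nlinarith [mul_nonneg hL0 (sq_nonneg δ)]
  nlinarith

lemma aux_gPot (n f₀ : ℕ) (τ α : ℝ) (hn : 2 ≤ n) (hτ : 2 ≤ τ)
    (hα : α = 1 - (1 / τ) * Real.log (1 + 1 / τ)) (hf : α * n ≤ f₀) (hfn : f₀ ≤ n) (x : Pt n) :
    ∑ y, mutProb n x y * gPot n τ f₀ y ≤ Real.exp (2 / τ - 1) * gPot n τ f₀ x + 1 := by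
  have hn' : (2 : ℝ) ≤ n := by exact_mod_cast hn
  have hn0 : (0 : ℝ) < n := by linarith
  have hτ0 : 0 < τ := by linarith
  have hb : ∀ y : Pt n, gPot n τ f₀ y ≤ τ ^ (oneMax y) / τ ^ f₀ := by
    intro y
    unfold gPot
    split_ifs with h
    · rw [pow_sub₀ _ hτ0.ne' h]; rfl
    · positivity
  have h1 : ∑ y, mutProb n x y * gPot n τ f₀ y ≤
      (∑ y, mutProb n x y * τ ^ (oneMax y)) / τ ^ f₀ := by
    rw [Finset.sum_div]
    refine Finset.sum_le_sum fun y _ => ?_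
    rw [mul_div_assoc]
    exact mul_le_mul_of_nonneg_left (hb y) (aux_mut_nonneg n (by omega) x y)
  refine h1.trans ?_
  rw [aux_mgf]
  set A := 1 + (τ - 1) / n with hA
  set B := 1 - (1 - 1 / τ) / n with hB
  have eA : (1 - 1 / (n : ℝ)) + 1 / (n : ℝ) * τ = A := by rw [hA]; ring
  have eB : (1 - 1 / (n : ℝ)) * τ + 1 / (n : ℝ) = τ * B := by
    rw [hB]; field_simp; ring
  rw [eA, eB]
  have hA0 : 0 ≤ A := by
    have : 0 ≤ (τ - 1) / n := div_nonneg (by linarith) hn0.le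
    linarith
  have hAB : A ≤ τ * B := by
    rw [← eA, ← eB]
    have : 1 / (n : ℝ) ≤ 1 / 2 := one_div_le_one_div_of_le (by norm_num) hn'
    nlinarith
  have hB0 : 0 ≤ B := by nlinarith
  have hk := aux_oneMax_le x
  rw [mul_pow]
  by_cases h : f₀ ≤ oneMax x
  · have hc := aux_core n (oneMax x) τ α hn (by linarith) hk hα
      (hf.trans (by exact_mod_cast h))
    rw [← hA, ← hB] at hc
    unfold gPot
    rw [if_pos h, pow_sub₀ _ hτ0.ne' h]
    have : τ ^ oneMax x * B ^ oneMax x * A ^ (n - oneMax x) / τ ^ f₀ =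
      (B ^ oneMax x * A ^ (n - oneMax x)) * (τ ^ oneMax x * (τ ^ f₀)⁻¹) := by
      rw [div_eq_mul_inv]; ring
    rw [this]
    have := mul_le_mul_of_nonneg_right hc (show 0 ≤ τ ^ oneMax x * (τ ^ f₀)⁻¹ by positivity)
    linarith
  · have hc := aux_core n f₀ τ α hn (by linarith) hfn hα hf
    rw [← hA, ← hB] at hc
    unfold gPot
    rw [if_neg h, mul_zero, zero_add, div_le_one (by positivity)]
    have he : Real.exp (2 / τ - 1) ≤ 1 := by
      rw [Real.exp_le_one_iff]
      have : 2 / τ ≤ 1 := by rw [div_le_one hτ0]; exact hτ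
      linarith
    obtain ⟨d, hd⟩ : ∃ d, f₀ = oneMax x + d := ⟨f₀ - oneMax x, by omega⟩
    have e1 : n - oneMax x = d + (n - f₀) := by omega
    rw [e1, pow_add A]
    have hp : A ^ d ≤ τ ^ d * B ^ d := by
      rw [← mul_pow]; exact pow_le_pow_left₀ hA0 hAB d
    calc τ ^ oneMax x * B ^ oneMax x * (A ^ d * A ^ (n - f₀))
        ≤ τ ^ oneMax x * B ^ oneMax x * ((τ ^ d * B ^ d) * A ^ (n - f₀)) := by gcongr
      _ = τ ^ f₀ * (B ^ f₀ * A ^ (n - f₀)) := by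
          rw [hd, pow_add, pow_add]; ring
      _ ≤ τ ^ f₀ * 1 := by
          gcongr
          exact hc.trans he
      _ = τ ^ f₀ := mul_one _

/-- For constant `ε ∈ (0,1)` and positive integers `μ ≤ λ ≤ (1-ε)eμ`,
for all sufficiently large `n`: in the (μ,λ) EA on OneMax, for every population `P`,
`E[g(P_{t+1}) | P_t = P] ≤ g(P) + 2λ`, where the potential is built from `τ = 4e/ε`. -/
theorem stmt11 (ε τ α : ℝ) (hε₁ : 0 < ε) (hε₂ : ε < 1)
    (hτ : τ = 4 * Real.exp 1 / ε)
    (hα : α = 1 - (1 / τ) * Real.log (1 + 1 / τ)) :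
    ∃ n₀ : ℕ, ∀ n ≥ n₀, ∀ μ lam : ℕ, 0 < μ → μ ≤ lam →
      (lam : ℝ) ≤ (1 - ε) * Real.exp 1 * (μ : ℝ) →
      ∀ P : Fin μ → Pt n,
        ∑ Q : Fin μ → Pt n, stepProb n μ lam P Q * gPop n μ τ ⌈α * (n : ℝ)⌉₊ Q
          ≤ gPop n μ τ ⌈α * (n : ℝ)⌉₊ P + 2 * (lam : ℝ) := by
  refine ⟨2, ?_⟩
  intro n hn μ lam hμ hml hlam P
  have he : (2 : ℝ) ≤ Real.exp 1 := by linarith [Real.add_one_le_exp (1 : ℝ)]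
  have hτ2 : 2 ≤ τ := by
    rw [hτ, le_div_iff₀ hε₁]; linarith
  have hτ0 : 0 < τ := by linarith
  have hα1 : α ≤ 1 := by
    have : 0 ≤ Real.log (1 + 1 / τ) := Real.log_nonneg (by
      have : 0 < 1 / τ := by positivity
      linarith)
    have : 0 ≤ (1 / τ) * Real.log (1 + 1 / τ) := by positivity
    linarith
  have hf := Nat.le_ceil (α * (n : ℝ))
  have hfn : ⌈α * (n : ℝ)⌉₊ ≤ n := by
    rw [Nat.ceil_le]
    have : (0 : ℝ) ≤ n := Nat.cast_nonneg n
    nlinarith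
  generalize ⌈α * (n : ℝ)⌉₊ = f₀ at hf hfn
  have hG : ∀ x, 0 ≤ gPot n τ f₀ x := by
    intro x
    unfold gPot
    split_ifs <;> positivity
  have hstep := aux_step n μ lam (by omega) hμ P (gPot n τ f₀) hG
  unfold gPop
  refine hstep.trans ?_
  have hμ' : (0 : ℝ) < μ := by exact_mod_cast hμ
  set S := ∑ i, gPot n τ f₀ (P i) with hS
  have hS0 : 0 ≤ S := Finset.sum_nonneg fun i _ => hG _
  set c := Real.exp (2 / τ - 1) with hc
  have hsum : ∑ y, offProb n μ P y * gPot n τ f₀ y ≤ (c * S + μ) / μ := by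
    unfold offProb
    simp_rw [div_mul_eq_mul_div]
    rw [← Finset.sum_div]
    gcongr
    simp_rw [Finset.sum_mul]
    rw [Finset.sum_comm]
    refine (Finset.sum_le_sum fun i _ =>
      aux_gPot n f₀ τ α hn hτ2 hα hf hfn (P i)).trans ?_
    rw [Finset.sum_add_distrib, ← Finset.mul_sum]
    simp [hS, hc]
  have hlam0 : (0 : ℝ) ≤ lam := Nat.cast_nonneg _
  refine (mul_le_mul_of_nonneg_left hsum hlam0).trans ?_
  have hc1 : (1 - ε) * Real.exp 1 * c ≤ 1 := by
    have h1 : 2 / τ ≤ ε := by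
      rw [div_le_iff₀ hτ0, hτ]
      field_simp
      linarith
    have h2 : 1 - ε ≤ Real.exp (-ε) := by linarith [Real.add_one_le_exp (-ε)]
    calc (1 - ε) * Real.exp 1 * c ≤ Real.exp (-ε) * Real.exp 1 * c := by
          gcongr
      _ = Real.exp (-ε + 1 + (2 / τ - 1)) := by rw [hc, Real.exp_add, Real.exp_add]
      _ ≤ 1 := by rw [Real.exp_le_one_iff]; linarith
  have hr : (lam : ℝ) / μ ≤ (1 - ε) * Real.exp 1 := by rw [div_le_iff₀ hμ']; exact hlam
  have hc0 : 0 ≤ c := (Real.exp_pos _).le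
  have e : (lam : ℝ) * ((c * S + μ) / μ) = (lam / μ * c) * S + lam := by
    field_simp
  rw [e]
  have h1 : (lam : ℝ) / μ * c ≤ 1 := (mul_le_mul_of_nonneg_right hr hc0).trans hc1
  have h2 := mul_le_mul_of_nonneg_right h1 hS0
  linarith
end

section
/- Let ε ∈ (0,1), τ = 4e/ε, α = 1 − (1/τ)·ln(1 + 1/τ), f_0 = ⌈α·n⌉, and let P_0 be a multiset of μ points drawn independently and uniformly at random from {0,1}^n. If μ = μ(n) is sub-exponential in n and n is large enough, then E[max{0, τ^{n − f_0} − g(P_0)}] ≥ (1/2)·τ^{n − f_0}. -/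
open Finset
open scoped ENNReal

attribute [local instance] Classical.propDecidable

theorem aux_gPot_le (n : ℕ) (τ : ℝ) (f₀ : ℕ) (hτ : 0 < τ) (x : Pt n) :
    gPot n τ f₀ x ≤ τ ^ (n - f₀) * ∏ i, (if x i = true then 1 else 1 / τ) := by
  have hprod : (∏ i, (if x i = true then (1 : ℝ) else 1 / τ)) = (1 / τ) ^ (n - oneMax x) := by
    rw [Finset.prod_ite, Finset.prod_const, Finset.prod_const, one_pow, one_mul]
    congr 1
    have h := Finset.card_filter_add_card_filter_not (s := (univ : Finset (Fin n)))
      (fun i => x i = true)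
    rw [Finset.card_univ, Fintype.card_fin] at h
    unfold oneMax
    omega
  have hle : oneMax x ≤ n := by
    unfold oneMax
    exact (Finset.card_le_univ _).trans (by simp)
  rw [hprod]
  unfold gPot
  split_ifs with h
  · have : n - f₀ = (oneMax x - f₀) + (n - oneMax x) := by omega
    rw [this, pow_add, mul_assoc, ← mul_pow, mul_one_div_cancel hτ.ne', one_pow, mul_one]
  · positivity

theorem aux_sum_gPot (n : ℕ) (τ : ℝ) (f₀ : ℕ) (hτ : 0 < τ) :
    ∑ x : Pt n, gPot n τ f₀ x ≤ τ ^ (n - f₀) * (1 + 1 / τ) ^ n := by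
  refine (Finset.sum_le_sum fun x _ => aux_gPot_le n τ f₀ hτ x).trans ?_
  rw [← Finset.mul_sum]
  have h := Fintype.prod_sum (fun (_ : Fin n) (b : Bool) => if b = true then (1 : ℝ) else 1 / τ)
  rw [← h]
  simp

theorem aux_marg (n m : ℕ) (g : Pt n → ℝ) (i : Fin m) :
    ∑ P : Fin m → Pt n, ((1 : ℝ) / 2 ^ n) ^ m * g (P i) = (1 / 2 ^ n) * ∑ x, g x := by
  have h := Fintype.prod_sum
    (fun (j : Fin m) (x : Pt n) => (1 : ℝ) / 2 ^ n * if j = i then g x else 1)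
  have e : ∀ P : Fin m → Pt n, ((1 : ℝ) / 2 ^ n) ^ m * g (P i) =
      ∏ j, ((1 : ℝ) / 2 ^ n * if j = i then g (P j) else 1) := by
    intro P
    rw [Finset.prod_mul_distrib, Finset.prod_ite_eq' univ i (fun j => g (P j))]
    simp
  rw [Finset.sum_congr rfl fun P _ => e P, ← h, Finset.prod_eq_single i]
  · simp [Finset.mul_sum]
  · intro j _ hj
    simp [hj]
  · simp

/-- With `τ = 4e/ε`, `α = 1 - (1/τ)ln(1 + 1/τ)`, `f₀ = ⌈αn⌉` and `P₀`
a population of `μ(n)` points chosen independently and uniformly at random, if `μ` is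
sub-exponential then `E[max{0, τ^{n-f₀} - g(P₀)}] ≥ (1/2) τ^{n-f₀}` for `n` large. -/
theorem stmt12 (ε τ α : ℝ) (hε₁ : 0 < ε) (hε₂ : ε < 1)
    (hτ : τ = 4 * Real.exp 1 / ε)
    (hα : α = 1 - (1 / τ) * Real.log (1 + 1 / τ))
    (μ : ℕ → ℕ)
    (hsub : ∀ c : ℝ, 0 < c → ∃ n₁ : ℕ, ∀ n ≥ n₁, (μ n : ℝ) ≤ Real.exp (c * (n : ℝ))) :
    ∃ n₀ : ℕ, ∀ n ≥ n₀,
      (1 / 2) * τ ^ (n - ⌈α * (n : ℝ)⌉₊)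
        ≤ ∑ P : Fin (μ n) → Pt n, ((1 : ℝ) / 2 ^ n) ^ (μ n) *
            max 0 (τ ^ (n - ⌈α * (n : ℝ)⌉₊) - gPop n (μ n) τ ⌈α * (n : ℝ)⌉₊ P) := by
  have he := Real.add_one_le_exp (1 : ℝ)
  have hτ4 : 4 < τ := by
    rw [hτ, lt_div_iff₀ hε₁]
    linarith
  have hτ0 : 0 < τ := by linarith
  obtain ⟨n₁, hn₁⟩ := hsub (1 / 10) (by norm_num)
  refine ⟨max n₁ 3, fun n hn => ?_⟩
  have hμ := hn₁ n (le_trans (le_max_left _ _) hn)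
  have hn3 : 3 ≤ n := le_trans (le_max_right _ _) hn
  generalize ⌈α * (n : ℝ)⌉₊ = f₀
  generalize μ n = m at hμ ⊢
  set T := τ ^ (n - f₀) with hT
  have hT0 : 0 < T := by positivity
  have h1 : ∑ P : Fin m → Pt n, ((1 : ℝ) / 2 ^ n) ^ m * (T - gPop n m τ f₀ P)
      = T - m * ((1 / 2 ^ n) * ∑ x, gPot n τ f₀ x) := by
    simp only [mul_sub, Finset.sum_sub_distrib]
    congr 1
    · rw [Finset.sum_const, Finset.card_univ]
      simp only [Fintype.card_fun, Fintype.card_bool, Fintype.card_fin, nsmul_eq_mul]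
      push_cast
      rw [← mul_assoc, ← mul_pow, mul_one_div_cancel (by positivity), one_pow, one_mul]
    · unfold gPop
      simp only [Finset.mul_sum (s := (univ : Finset (Fin m)))]
      rw [Finset.sum_comm, Finset.sum_congr rfl fun i _ => aux_marg n m (gPot n τ f₀) i]
      simp
  have h2 : ∑ P : Fin m → Pt n, ((1 : ℝ) / 2 ^ n) ^ m * (T - gPop n m τ f₀ P) ≤
      ∑ P : Fin m → Pt n, ((1 : ℝ) / 2 ^ n) ^ m * max 0 (T - gPop n m τ f₀ P) :=
    Finset.sum_le_sum fun P _ => mul_le_mul_of_nonneg_left (le_max_right _ _) (by positivity)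
  refine le_trans ?_ h2
  rw [h1]
  have h3 := aux_sum_gPot n τ f₀ hτ0
  rw [← hT] at h3
  have hq : 1 + 1 / τ ≤ 5 / 4 := by
    have : 1 / τ ≤ 1 / 4 := one_div_le_one_div_of_le (by norm_num) hτ4.le
    linarith
  have hexp : Real.exp (1 / 10) ≤ 6 / 5 := by
    have h := Real.exp_bound_div_one_sub_of_interval (x := 1 / 10) (by norm_num) (by norm_num)
    exact h.trans (by norm_num)
  have hm : (m : ℝ) ≤ (6 / 5) ^ n := by
    refine hμ.trans ?_
    rw [mul_comm, Real.exp_nat_mul]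
    gcongr
  have h4 : (m : ℝ) * ((1 / 2 ^ n) * ∑ x, gPot n τ f₀ x) ≤
      (6 / 5) ^ n * ((1 / 2 ^ n) * (T * (5 / 4) ^ n)) := by
    have h5 : ∑ x : Pt n, gPot n τ f₀ x ≤ T * (5 / 4) ^ n := by
      refine h3.trans ?_
      gcongr
    refine (mul_le_mul_of_nonneg_left (mul_le_mul_of_nonneg_left h5 (by positivity))
      (by positivity)).trans ?_
    gcongr
  have h6 : (6 / 5 : ℝ) ^ n * ((1 / 2 ^ n) * (T * (5 / 4) ^ n)) = T * (3 / 4) ^ n := by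
    have : (3 / 4 : ℝ) ^ n = (6 / 5) ^ n * (1 / 2) ^ n * (5 / 4) ^ n := by
      rw [← mul_pow, ← mul_pow]; norm_num
    rw [this, one_div_pow]; ring
  have h7 : (3 / 4 : ℝ) ^ n ≤ 1 / 2 :=
    (pow_le_pow_of_le_one (by norm_num) (by norm_num) hn3).trans (by norm_num)
  have h8 : T * (3 / 4) ^ n ≤ T * (1 / 2) := mul_le_mul_of_nonneg_left h7 hT0.le
  linarith
end

section
/- The irrationality exponent of Euler's number e equals 2. Concretely: (i) for every real d > 2, the set {(p,q) ∈ ℕ × ℕ : q ≥ 1 and |e − p/q| ≤ 1/q^d} is finite; (ii) for d = 2, the set {(p,q) ∈ ℕ × ℕ : q ≥ 1 and |e − p/q| ≤ 1/q^2} is infinite. -/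
open Finset
open scoped ENNReal

attribute [local instance] Classical.propDecidable

namespace EExp

noncomputable def g (n : ℕ) (x : ℝ) : ℝ := (x * (1 - x)) ^ n / (n.factorial : ℝ)

lemma g_deriv (n : ℕ) (x : ℝ) : HasDerivAt (g (n + 1)) (g n x * (1 - 2 * x)) x := by
  have h1 : HasDerivAt (fun x : ℝ => x * (1 - x)) (1 - 2 * x) x := by
    have h := (hasDerivAt_id' x).mul ((hasDerivAt_const x (1 : ℝ)).sub (hasDerivAt_id' x))
    refine h.congr_deriv ?_
    simp only [Pi.sub_apply]
    ring
  have h2 := (h1.pow (n + 1)).div_const ((n + 1).factorial : ℝ)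
  refine h2.congr_deriv ?_
  unfold g
  have : (n.factorial : ℝ) ≠ 0 := by positivity
  have : (n : ℝ) + 1 ≠ 0 := by positivity
  rw [Nat.factorial_succ]
  push_cast
  field_simp
  try simp

lemma g_succ (n : ℕ) (x : ℝ) : x * (1 - x) * g n x = (n + 1) * g (n + 1) x := by
  unfold g
  have : (n.factorial : ℝ) ≠ 0 := by positivity
  have : (n : ℝ) + 1 ≠ 0 := by positivity
  rw [Nat.factorial_succ]
  push_cast
  field_simp
  ring

lemma g_cont (n : ℕ) : Continuous (g n) := by
  unfold g
  fun_prop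

noncomputable def A (n : ℕ) : ℝ := ∫ x in (0 : ℝ)..1, g n x * Real.exp x

lemma A_int (n : ℕ) : IntervalIntegrable (fun x => g n x * Real.exp x) MeasureTheory.volume 0 1 :=
  ((g_cont n).mul Real.continuous_exp).intervalIntegrable _ _

lemma A_pos (n : ℕ) : 0 < A n := by
  refine intervalIntegral.intervalIntegral_pos_of_pos_on (A_int n) ?_ one_pos
  intro x hx
  have h1 : 0 < x := hx.1
  have h2 : 0 < 1 - x := by linarith [hx.2]
  unfold g
  positivity

lemma A_rec (n : ℕ) : A (n + 2) = A n - (4 * n + 6) * A (n + 1) := by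
  have key : ∫ x in (0 : ℝ)..1, (g n x * Real.exp x - (4 * n + 6) * (g (n + 1) x * Real.exp x)
      - g (n + 2) x * Real.exp x) = 0 := by
    have := intervalIntegral.integral_eq_sub_of_hasDerivAt (a := 0) (b := 1)
      (f := fun x => (g (n + 1) x * (1 - 2 * x) - g (n + 2) x) * Real.exp x)
      (f' := fun x => g n x * Real.exp x - (4 * n + 6) * (g (n + 1) x * Real.exp x)
      - g (n + 2) x * Real.exp x) ?_ ?_
    · rw [this]
      simp [g]
    · intro x _
      have h1 : HasDerivAt (fun x : ℝ => 1 - 2 * x) (-2) x := by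
        simpa using ((hasDerivAt_id' x).const_mul 2).const_sub 1
      have h2 := (((g_deriv n x).mul h1).sub (g_deriv (n + 1) x)).mul (Real.hasDerivAt_exp x)
      refine h2.congr_deriv ?_
      simp only [Pi.sub_apply, Pi.mul_apply]
      linear_combination (-4 * Real.exp x) * g_succ n x
    · exact (((A_int n).sub ((A_int (n + 1)).const_mul _)).sub (A_int (n + 2)))
  rw [intervalIntegral.integral_sub ((A_int n).sub ((A_int (n + 1)).const_mul _)) (A_int (n + 2)),
    intervalIntegral.integral_sub (A_int n) ((A_int (n + 1)).const_mul _),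
    intervalIntegral.integral_const_mul] at key
  unfold A
  linarith

lemma A_zero : A 0 = Real.exp 1 - 1 := by
  simp [A, g]

lemma A_one : A 1 = 3 - Real.exp 1 := by
  have := intervalIntegral.integral_eq_sub_of_hasDerivAt (a := 0) (b := 1)
      (f := fun x => (-(x ^ 2) + 3 * x - 3) * Real.exp x)
      (f' := fun x => g 1 x * Real.exp x) ?_ (A_int 1)
  · rw [A, this]
    simp
    ring
  · intro x _
    have h1 : HasDerivAt (fun x : ℝ => -(x ^ 2) + 3 * x - 3) (-(2 * x) + 3) x := by
      have := (((hasDerivAt_pow 2 x).neg).add ((hasDerivAt_id' x).const_mul 3)).sub_const 3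
      simpa using this
    refine (h1.mul (Real.hasDerivAt_exp x)).congr_deriv ?_
    simp [g]
    ring

def Q : ℕ → ℕ
  | 0 => 1
  | 1 => 1
  | n + 2 => Q n + (4 * n + 6) * Q (n + 1)

def P : ℕ → ℕ
  | 0 => 1
  | 1 => 3
  | n + 2 => P n + (4 * n + 6) * P (n + 1)

lemma A_eq (n : ℕ) : A n = (-1) ^ n * (Q n * Real.exp 1 - P n) ∧
    A (n + 1) = (-1) ^ (n + 1) * (Q (n + 1) * Real.exp 1 - P (n + 1)) := by
  induction n with
  | zero => 
    rw [A_zero, A_one]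
    simp [Q, P]
  | succ n ih =>
    refine ⟨ih.2, ?_⟩
    rw [A_rec, ih.1, ih.2, show Q (n + 1 + 1) = Q n + (4 * n + 6) * Q (n + 1) from rfl,
      show P (n + 1 + 1) = P n + (4 * n + 6) * P (n + 1) from rfl]
    push_cast
    ring

lemma Q_pos (n : ℕ) : 0 < Q n ∧ 0 < Q (n + 1) := by
  induction n with
  | zero => simp [Q]
  | succ n ih => exact ⟨ih.2, by rw [Q]; omega⟩

lemma Q_le (n : ℕ) : Q n ≤ Q (n + 1) ∧ Q (n + 1) ≤ (4 * n + 7) * Q n := by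
  cases n with
  | zero => simp [Q]
  | succ n =>
    have : Q n ≤ Q (n + 1) := by
      cases n with
      | zero => simp [Q]
      | succ n => rw [Q]; nlinarith
    rw [show Q (n + 1 + 1) = Q n + (4 * n + 6) * Q (n + 1) from rfl]
    constructor <;> nlinarith

lemma two_pow_le (n : ℕ) : 2 ^ n ≤ 2 * Q n := by
  induction n with
  | zero => simp [Q]
  | succ n ih =>
    cases n with
    | zero => simp [Q]
    | succ n =>
      rw [show Q (n + 1 + 1) = Q n + (4 * n + 6) * Q (n + 1) from rfl, pow_succ]
      nlinarith

lemma inv (n : ℕ) : Q (n + 1) * A n + Q n * A (n + 1) = 2 := by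
  induction n with
  | zero => 
    rw [A_zero, A_one]
    simp [Q]
    norm_num
  | succ n ih =>
    rw [A_rec, show Q (n + 1 + 1) = Q n + (4 * n + 6) * Q (n + 1) from rfl]
    push_cast
    linarith

lemma det (n : ℕ) : (Q n : ℤ) * P (n + 1) - Q (n + 1) * P n = 2 * (-1) ^ n := by
  induction n with
  | zero => simp [Q, P]
  | succ n ih =>
    rw [show Q (n + 1 + 1) = Q n + (4 * n + 6) * Q (n + 1) from rfl,
      show P (n + 1 + 1) = P n + (4 * n + 6) * P (n + 1) from rfl, pow_succ]
    push_cast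
    linarith

lemma lower_aux (n p q : ℕ) (hq : 4 * q ≤ Q (n + 1))
    (hne : (p : ℤ) * Q n - q * P n ≠ 0) :
    1 / 2 ≤ (Q n : ℝ) * |q * Real.exp 1 - p| := by
  have h1 : (1 : ℝ) ≤ |(p : ℝ) * Q n - q * P n| := by
    have := Int.one_le_abs hne
    exact_mod_cast this
  have hA : |(Q n : ℝ) * Real.exp 1 - P n| = A n := by
    rw [← abs_of_pos (A_pos n), (A_eq n).1, abs_mul]
    simp
  have h2 : (p : ℝ) * Q n - q * P n =
      -(Q n * (q * Real.exp 1 - p)) + q * (Q n * Real.exp 1 - P n) := by ring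
  have h3 := abs_add_le (-(Q n * (q * Real.exp 1 - p))) (q * (Q n * Real.exp 1 - P n))
  rw [← h2, abs_neg, abs_mul, abs_mul, hA, Nat.abs_cast, Nat.abs_cast] at h3
  have h4 : (q : ℝ) * A n ≤ 1 / 2 := by
    have i := inv n
    have i2 : 0 ≤ Q n * A (n + 1) := mul_nonneg (Nat.cast_nonneg _) (A_pos _).le
    have hq' : (4 : ℝ) * q ≤ Q (n + 1) := by exact_mod_cast hq
    have := mul_le_mul_of_nonneg_right hq' (A_pos n).le
    linarith
  linarith

lemma lower (n p q : ℕ) (hq0 : 1 ≤ q) (hq : 4 * q ≤ Q (n + 1)) :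
    1 / 2 ≤ (Q (n + 1) : ℝ) * |q * Real.exp 1 - p| := by
  by_cases hne : (p : ℤ) * Q n - q * P n = 0
  · refine lower_aux (n + 1) p q (hq.trans (Q_le (n + 1)).1) ?_
    intro h0
    have d := det n
    have : (q : ℤ) * (2 * (-1) ^ n) = 0 := by
      rw [← d]
      linear_combination (-(Q n : ℤ)) * h0 + (Q (n + 1) : ℤ) * hne
    simp at this
    omega
  · refine (lower_aux n p q hq hne).trans ?_
    gcongr
    exact (Q_le n).1

lemma main_bound (p q : ℕ) (hq0 : 1 ≤ q) :
    1 / 2 ≤ (8 * Real.log (8 * q) + 7) * (4 * q) * (q * |Real.exp 1 - (p : ℝ) / q|) := by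
  have hex : ∃ m, 4 * q ≤ Q m := by
    refine ⟨8 * q, ?_⟩
    have := two_pow_le (8 * q)
    have := (Nat.lt_two_pow_self (n := 8 * q))
    omega
  classical
  obtain ⟨m, hm, hmin⟩ : ∃ m, 4 * q ≤ Q m ∧ ∀ k < m, Q k < 4 * q :=
    ⟨Nat.find hex, Nat.find_spec hex, fun k hk => not_le.mp (Nat.find_min hex hk)⟩
  cases m with
  | zero => simp [Q] at hm; omega
  | succ n =>
    have hn := hmin n (Nat.lt_succ_self n)
    have hq : (0 : ℝ) < q := by exact_mod_cast hq0
    have hlog : (n : ℝ) ≤ 2 * Real.log (8 * q) := by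
      have h2 : (2 : ℝ) ^ n ≤ 8 * q := by
        have : 2 ^ n ≤ 8 * q := by have := two_pow_le n; omega
        exact_mod_cast this
      have := Real.log_le_log (by positivity) h2
      rw [Real.log_pow] at this
      have l2 := Real.log_two_gt_d9
      have : (n : ℝ) * (1 / 2) ≤ n * Real.log 2 := by gcongr; linarith
      linarith
    have e1 : |q * Real.exp 1 - p| = q * |Real.exp 1 - (p : ℝ) / q| := by
      rw [← Nat.abs_cast q, ← abs_mul, Nat.abs_cast]
      congr 1
      field_simp
    refine (lower n p q hq0 hm).trans ?_
    rw [e1]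
    gcongr
    have h1 : (Q (n + 1) : ℝ) ≤ (4 * n + 7) * Q n := by exact_mod_cast (Q_le n).2
    have h2 : (Q n : ℝ) ≤ 4 * q := by exact_mod_cast hn.le
    calc (Q (n + 1) : ℝ) ≤ (4 * n + 7) * Q n := h1
      _ ≤ (4 * n + 7) * (4 * q) := by gcongr
      _ ≤ _ := mul_le_mul_of_nonneg_right (by linarith) (by positivity)

lemma part1 (d : ℝ) (hd : 2 < d) :
      {pq : ℕ × ℕ | 1 ≤ pq.2 ∧
        |Real.exp 1 - (pq.1 : ℝ) / (pq.2 : ℝ)| ≤ 1 / ((pq.2 : ℝ) ^ d)}.Finite := by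
  have hlim : ∀ᶠ x : ℝ in Filter.atTop, 8 * (8 * Real.log (8 * x) + 7) < x ^ (d - 2) := by
    have h1 := (isLittleO_log_rpow_atTop (sub_pos.2 hd)).bound
      (show (0 : ℝ) < 1 / 128 by norm_num)
    have h2 := (tendsto_rpow_atTop (sub_pos.2 hd)).eventually_gt_atTop
      (2 * (8 * (8 * Real.log 8 + 7)))
    filter_upwards [h1, h2, Filter.eventually_gt_atTop 0] with x h1 h2 hx
    rw [Real.log_mul (by norm_num) hx.ne']
    have h3 := (le_abs_self _).trans h1
    rw [Real.norm_of_nonneg (by positivity)] at h3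
    linarith
  obtain ⟨B, hB⟩ := Filter.eventually_atTop.1 hlim
  refine ((Set.finite_Iic (4 * ⌈B⌉₊)).prod (Set.finite_Iic ⌈B⌉₊)).subset ?_
  rintro ⟨p, q⟩ ⟨hq0, h⟩
  simp only at hq0 h
  have hq : (0 : ℝ) < q := by exact_mod_cast hq0
  have hq1 : (1 : ℝ) ≤ q := by exact_mod_cast hq0
  have hqB : (q : ℝ) < B := by
    by_contra hc
    have hb := hB q (not_lt.1 hc)
    have m := main_bound p q hq0
    have hl : 0 ≤ Real.log (8 * q) := Real.log_nonneg (by linarith)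
    have m2 : 1 / 2 ≤ (8 * Real.log (8 * q) + 7) * (4 * q) * (q * (1 / (q : ℝ) ^ d)) :=
      m.trans (by gcongr)
    have e : (q : ℝ) ^ d = q ^ (d - 2) * q ^ 2 := by
      rw [← Real.rpow_natCast, ← Real.rpow_add hq]; congr 1; push_cast; ring
    rw [e] at m2
    have hp : 0 < (q : ℝ) ^ (d - 2) := by positivity
    have e2 : (8 * Real.log (8 * q) + 7) * (4 * q) * (q * (1 / ((q : ℝ) ^ (d - 2) * q ^ 2)))
      = (8 * Real.log (8 * q) + 7) * 4 / (q : ℝ) ^ (d - 2) := by field_simp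
    rw [e2, le_div_iff₀ hp] at m2
    linarith
  have hqn : q ≤ ⌈B⌉₊ := by
    have := hqB.le.trans (Nat.le_ceil B)
    exact_mod_cast this
  refine ⟨?_, hqn⟩
  have h1 : 1 / (q : ℝ) ^ d ≤ 1 := by
    rw [div_le_one (by positivity)]
    exact Real.one_le_rpow hq1 (by linarith)
  have h2 := (abs_le.1 (h.trans h1)).1
  have h3 : (p : ℝ) / q ≤ 4 := by linarith [Real.exp_one_lt_d9]
  rw [div_le_iff₀ hq] at h3
  have h4 : p ≤ 4 * q := by exact_mod_cast h3
  simp only [Set.mem_Iic]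
  omega

lemma part2 : {pq : ℕ × ℕ | 1 ≤ pq.2 ∧
      |Real.exp 1 - (pq.1 : ℝ) / (pq.2 : ℝ)| ≤ 1 / ((pq.2 : ℝ) ^ (2 : ℕ))}.Infinite := by
  have hmono : StrictMono (fun n => Q (n + 1)) := by
    refine strictMono_nat_of_lt_succ fun n => ?_
    have := Q_pos n
    rw [show Q (n + 1 + 1) = Q n + (4 * n + 6) * Q (n + 1) from rfl]
    nlinarith
  have hinj : Function.Injective (fun n => (P (n + 2), Q (n + 2))) := by
    intro a b h
    have := hmono.injective (a₁ := a + 1) (a₂ := b + 1) (Prod.ext_iff.1 h).2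
    omega
  refine (Set.infinite_range_of_injective hinj).mono ?_
  rintro _ ⟨n, rfl⟩
  refine ⟨(Q_pos _).1, ?_⟩
  simp only
  set k := n + 2 with hk
  have hq : (0 : ℝ) < Q k := by exact_mod_cast (Q_pos k).1
  have hA : |(Q k : ℝ) * Real.exp 1 - P k| = A k := by
    rw [← abs_of_pos (A_pos k), (A_eq k).1, abs_mul]
    simp
  have e1 : |Real.exp 1 - (P k : ℝ) / Q k| = A k / Q k := by
    rw [← hA, ← abs_of_pos hq, ← abs_div, abs_of_pos hq]
    congr 1
    field_simp
  have h2 : (2 : ℝ) * Q k ≤ Q (k + 1) := by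
    have : 2 * Q k ≤ Q (k + 1) := by
      rw [hk, show Q (n + 2 + 1) = Q (n + 1) + (4 * (n + 1) + 6) * Q (n + 2) from rfl]
      nlinarith
    exact_mod_cast this
  have i := inv k
  have i2 : 0 ≤ Q k * A (k + 1) := mul_nonneg hq.le (A_pos _).le
  have := mul_le_mul_of_nonneg_right h2 (A_pos k).le
  rw [e1, div_le_div_iff₀ hq (by positivity)]
  nlinarith

end EExp

/-- The irrationality exponent of `e` equals 2: for every real `d > 2`
only finitely many pairs `(p,q)` with `q ≥ 1` satisfy `|e - p/q| ≤ 1/q^d`, while for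
`d = 2` there are infinitely many such pairs. -/
theorem stmt13 :
    (∀ d : ℝ, 2 < d →
      {pq : ℕ × ℕ | 1 ≤ pq.2 ∧
        |Real.exp 1 - (pq.1 : ℝ) / (pq.2 : ℝ)| ≤ 1 / ((pq.2 : ℝ) ^ d)}.Finite) ∧
    {pq : ℕ × ℕ | 1 ≤ pq.2 ∧
      |Real.exp 1 - (pq.1 : ℝ) / (pq.2 : ℝ)| ≤ 1 / ((pq.2 : ℝ) ^ (2 : ℕ))}.Infinite := by
  exact ⟨fun d hd => EExp.part1 d hd, EExp.part2⟩
end
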